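/- Let g ∈ ℝᵐ with gᵢ > 0 for all i, let γ > 0, and let a ∈ ℝᵐ. Then the function w ↦ γ·KL(w, g) + ½‖w − a‖², defined on the open positive orthant {w ∈ ℝᵐ : wᵢ > 0}, has a unique minimizer w*, given componentwise by w*ᵢ = ½(aᵢ − γ + √((aᵢ − γ)² + 4 γ gᵢ)). In particular, prox_{γ KL(·, g)}(a) admits this closed-form expression. -/

import Mathlib

/-- Generalized Kullback–Leibler divergence `KL(v, g) = Σᵢ (gᵢ log(gᵢ/vᵢ) + vᵢ − gᵢ)`. -/
noncomputable def genKL {m : ℕ} (v g : Fin m → ℝ) : ℝ :=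
  ∑ i, (g i * Real.log (g i / v i) + v i - g i)

/-- The positive root of `s² - (a - γ) s - γ g = 0` is positive and satisfies the equation. -/
lemma proxKL_root {g γ a s : ℝ} (hg : 0 < g) (hγ : 0 < γ)
    (hs : s = (1/2) * (a - γ + Real.sqrt ((a - γ)^2 + 4 * γ * g))) :
    0 < s ∧ s ^ 2 - (a - γ) * s = γ * g := by
  have hpos : 0 < γ * g := mul_pos hγ hg
  have hsq := Real.sq_sqrt (show 0 ≤ (a - γ)^2 + 4 * γ * g by nlinarith [sq_nonneg (a - γ)])
  have hlt : |a - γ| < Real.sqrt ((a - γ)^2 + 4 * γ * g) := by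
    rw [← Real.sqrt_sq_eq_abs]
    exact Real.sqrt_lt_sqrt (sq_nonneg _) (by linarith)
  refine ⟨?_, ?_⟩
  · linarith [neg_abs_le (a - γ)]
  · rw [hs]
    linear_combination (1/4) * hsq

/-- Quadratic growth of the scalar objective around its stationary point. -/
lemma proxKL_quadratic_growth {g γ a s w : ℝ} (hg : 0 < g) (hγ : 0 < γ) (hs : 0 < s)
    (hroot : s ^ 2 - (a - γ) * s = γ * g) (hw : 0 < w) :
    γ * (g * Real.log (g / s) + s - g) + (1/2) * (s - a)^2 + (1/2) * (w - s)^2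
      ≤ γ * (g * Real.log (g / w) + w - g) + (1/2) * (w - a)^2 := by
  have hlog := Real.log_le_sub_one_of_pos (div_pos hw hs)
  rw [Real.log_div hw.ne' hs.ne'] at hlog
  rw [Real.log_div hg.ne' hs.ne', Real.log_div hg.ne' hw.ne']
  have hmul := mul_le_mul_of_nonneg_left hlog (mul_pos hγ hg).le
  have hlin : γ * g * (w / s - 1) = (s - a + γ) * (w - s) := by
    rw [← hroot]
    field_simp
    ring
  rw [hlin] at hmul
  linarith

/-- Quadratic growth of the separable objective, summed over the coordinates. -/
lemma genKL_quadratic_growth {m : ℕ} {g a s w : Fin m → ℝ} {γ : ℝ} (hg : ∀ i, 0 < g i)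
    (hγ : 0 < γ) (hs : ∀ i, 0 < s i)
    (hroot : ∀ i, s i ^ 2 - (a i - γ) * s i = γ * g i) (hw : ∀ i, 0 < w i) :
    γ * genKL s g + (1/2) * ∑ i, (s i - a i)^2 + (1/2) * ∑ i, (w i - s i)^2
      ≤ γ * genKL w g + (1/2) * ∑ i, (w i - a i)^2 := by
  simp only [genKL, Finset.mul_sum, ← Finset.sum_add_distrib]
  exact Finset.sum_le_sum fun i _ =>
    proxKL_quadratic_growth (hg i) hγ (hs i) (hroot i) (hw i)

/-- Closed form of the proximal operator of the scaled KL term: the function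
`w ↦ γ·KL(w, g) + ½‖w − a‖²` on the open positive orthant has the unique minimizer
`w*ᵢ = ½(aᵢ − γ + √((aᵢ − γ)² + 4γgᵢ))`. -/
theorem stmt_4 {m : ℕ} (g : Fin m → ℝ) (hg : ∀ i, 0 < g i) (γ : ℝ) (hγ : 0 < γ)
    (a : Fin m → ℝ)
    (wstar : Fin m → ℝ)
    (hwstar : ∀ i, wstar i = (1/2) * (a i - γ + Real.sqrt ((a i - γ)^2 + 4 * γ * g i))) :
    (∀ i, 0 < wstar i) ∧
    (∀ w : Fin m → ℝ, (∀ i, 0 < w i) →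
      γ * genKL wstar g + (1/2) * ∑ i, (wstar i - a i)^2
        ≤ γ * genKL w g + (1/2) * ∑ i, (w i - a i)^2) ∧
    (∀ w : Fin m → ℝ, (∀ i, 0 < w i) →
      (∀ v : Fin m → ℝ, (∀ i, 0 < v i) →
        γ * genKL w g + (1/2) * ∑ i, (w i - a i)^2
          ≤ γ * genKL v g + (1/2) * ∑ i, (v i - a i)^2) →
      w = wstar) := by
  have hpos i := (proxKL_root (hg i) hγ (hwstar i)).1
  have hroot i := (proxKL_root (hg i) hγ (hwstar i)).2
  refine ⟨hpos, fun w hw => ?_, fun w hw hmin => ?_⟩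
  · have hgrowth := genKL_quadratic_growth hg hγ hpos hroot hw
    have hnonneg : 0 ≤ ∑ i, (w i - wstar i)^2 := Finset.sum_nonneg fun i _ => sq_nonneg _
    linarith
  · have hgrowth := genKL_quadratic_growth hg hγ hpos hroot hw
    have hle : ∑ i, (w i - wstar i)^2 ≤ 0 := by linarith [hmin wstar hpos]
    funext i
    have hi := Finset.single_le_sum (f := fun i => (w i - wstar i)^2)
      (fun j _ => sq_nonneg _) (Finset.mem_univ i)
    have hzero : (w i - wstar i)^2 = 0 := le_antisymm (hi.trans hle) (sq_nonneg _)
    exact sub_eq_zero.mp (pow_eq_zero_iff two_ne_zero |>.mp hzero)
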